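/- arXiv:1906.01481 — 4 statements merged into one kernel-verified Lean document; each statement's English description precedes it below -/
import Mathlib

section
/- Let f_i : ℝ^d → ℝ be convex, differentiable and L_i-smooth, and set f = (1/n) Σ_{i=1}^n f_i. Let p̃_i > 0 with Σ_i p̃_i = 1, let τ ≥ 1 be an integer, and draw i_1,…,i_τ independently with P[i_k = i] = p̃_i. Then for all x, y ∈ ℝ^d: E ‖(1/(nτ)) Σ_{k=1}^τ (1/p̃_{i_k})(∇f_{i_k}(x) − ∇f_{i_k}(y)) − (∇f(x) − ∇f(y))‖² ≤ (2/(nτ)) max_{i∈[n]} (L_i/p̃_i) · (f(x) − f(y) − ⟨∇f(y), x − y⟩). -/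
open scoped RealInnerProductSpace BigOperators

lemma aux_var {E : Type*} [NormedAddCommGroup E] [InnerProductSpace ℝ E] {n : ℕ}
    (p : Fin n → ℝ) (hp : ∑ i, p i = 1) (w : Fin n → E) (hw : ∑ i, p i • w i = 0) (m : ℕ) :
    ∀ c : E, ∑ idx : Fin m → Fin n, (∏ k, p (idx k)) * ‖c + ∑ k, w (idx k)‖ ^ 2
      = ‖c‖ ^ 2 + m * ∑ i, p i * ‖w i‖ ^ 2 := by
  induction m with
  | zero => intro c; simp
  | succ m ih =>
    intro c
    rw [← (Fin.consEquiv (fun _ : Fin (m+1) => Fin n)).sum_comp, Fintype.sum_prod_type]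
    have h1 : ∀ i : Fin n, ∑ idx : Fin m → Fin n,
        (∏ k, p ((Fin.consEquiv (fun _ : Fin (m+1) => Fin n)) (i, idx) k)) *
          ‖c + ∑ k, w ((Fin.consEquiv (fun _ : Fin (m+1) => Fin n)) (i, idx) k)‖ ^ 2
        = p i * (‖c‖ ^ 2 + ‖w i‖ ^ 2 + m * ∑ i, p i * ‖w i‖ ^ 2) + 2 * ⟪c, p i • w i⟫ := by
      intro i
      have h2 := ih (c + w i)
      rw [norm_add_sq_real] at h2
      rw [inner_smul_right]
      have h3 : p i * (‖c‖ ^ 2 + ‖w i‖ ^ 2 + m * ∑ i, p i * ‖w i‖ ^ 2) + 2 * (p i * ⟪c, w i⟫)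
        = p i * (‖c‖ ^ 2 + 2 * ⟪c, w i⟫ + ‖w i‖ ^ 2 + m * ∑ i, p i * ‖w i‖ ^ 2) := by ring
      rw [h3, ← h2, Finset.mul_sum]
      refine Finset.sum_congr rfl fun idx _ => ?_
      simp [Fin.consEquiv, Fin.prod_univ_succ, Fin.sum_univ_succ, add_assoc, mul_assoc]
    rw [Finset.sum_congr rfl fun i _ => h1 i, Finset.sum_add_distrib, ← Finset.mul_sum, ← inner_sum,
      hw]
    simp only [mul_add, Finset.sum_add_distrib, ← Finset.sum_mul, hp]
    simp
    ring

lemma aux_line {E : Type*} [NormedAddCommGroup E] [InnerProductSpace ℝ E] [CompleteSpace E]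
    {f : E → ℝ} {f' : E → E} (hg : ∀ x, HasGradientAt f (f' x) x) (x v : E) (t : ℝ) :
    HasDerivAt (fun s : ℝ => f (x + s • v)) ⟪f' (x + t • v), v⟫ t := by
  have h1 : HasDerivAt (fun s : ℝ => x + s • v) v t := by
    simpa using ((hasDerivAt_id t).smul_const v).const_add x
  have h2 := (hg (x + t • v)).hasFDerivAt.comp_hasDerivAt t h1
  have h3 : HasDerivAt (fun s : ℝ => f (x + s • v)) _ t := h2
  convert h3 using 1
  simp

lemma aux_desc {E : Type*} [NormedAddCommGroup E] [InnerProductSpace ℝ E] [CompleteSpace E]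
    {f : E → ℝ} {f' : E → E} (hg : ∀ x, HasGradientAt f (f' x) x) {L : ℝ} (hL : 0 ≤ L)
    (hs : LipschitzWith (Real.toNNReal L) f') (x v : E) :
    f (x + v) ≤ f x + ⟪f' x, v⟫ + L / 2 * ‖v‖ ^ 2 := by
  have hd : ∀ t : ℝ, HasDerivAt
      (fun s : ℝ => f (x + s • v) - s * ⟪f' x, v⟫ - s ^ 2 * (L / 2 * ‖v‖ ^ 2))
      (⟪f' (x + t • v), v⟫ - ⟪f' x, v⟫ - 2 * t * (L / 2 * ‖v‖ ^ 2)) t := by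
    intro t
    have h := ((aux_line hg x v t).sub ((hasDerivAt_id t).mul_const ⟪f' x, v⟫)).sub
      ((hasDerivAt_pow 2 t).mul_const (L / 2 * ‖v‖ ^ 2))
    have h' : HasDerivAt
      (fun s : ℝ => f (x + s • v) - s * ⟪f' x, v⟫ - s ^ 2 * (L / 2 * ‖v‖ ^ 2)) _ t := h
    convert h' using 1
    simp
  have ha := antitoneOn_of_deriv_nonpos (convex_Icc (0 : ℝ) 1)
    (fun t _ => (hd t).continuousAt.continuousWithinAt)
    (fun t _ => (hd t).differentiableAt.differentiableWithinAt) (by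
      intro t ht
      rw [interior_Icc] at ht
      rw [(hd t).deriv, ← inner_sub_left]
      have h1 := real_inner_le_norm (f' (x + t • v) - f' x) v
      have h2 := hs.dist_le_mul (x + t • v) x
      rw [dist_eq_norm, dist_eq_norm, Real.coe_toNNReal L hL, add_sub_cancel_left, norm_smul,
        Real.norm_of_nonneg ht.1.le] at h2
      have h3 := mul_le_mul_of_nonneg_right h2 (norm_nonneg v)
      nlinarith)
  have := ha (Set.left_mem_Icc.2 zero_le_one) (Set.right_mem_Icc.2 zero_le_one) zero_le_one
  simp at this
  linarith

lemma aux_conv {E : Type*} [NormedAddCommGroup E] [InnerProductSpace ℝ E] [CompleteSpace E]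
    {f : E → ℝ} {f' : E → E} (hg : ∀ x, HasGradientAt f (f' x) x)
    (hc : ConvexOn ℝ Set.univ f) (y z : E) :
    f y + ⟪f' y, z - y⟫ ≤ f z := by
  have h1 : ConvexOn ℝ Set.univ (fun s : ℝ => f (y + s • (z - y))) := by
    have := hc.comp_affineMap (AffineMap.lineMap y z)
    simpa [Function.comp_def, AffineMap.lineMap_apply, add_comm] using this
  have h2 := aux_line hg y (z - y) 0
  have := h1.le_slope_of_hasDerivAt (Set.mem_univ 0) (Set.mem_univ 1) zero_lt_one h2
  simp [slope] at this
  linarith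

lemma aux_coco {E : Type*} [NormedAddCommGroup E] [InnerProductSpace ℝ E] [CompleteSpace E]
    {f : E → ℝ} {f' : E → E} (hg : ∀ x, HasGradientAt f (f' x) x) {L : ℝ} (hL : 0 ≤ L)
    (hs : LipschitzWith (Real.toNNReal L) f') (hc : ConvexOn ℝ Set.univ f) (x y : E) :
    ‖f' x - f' y‖ ^ 2 ≤ 2 * L * (f x - f y - ⟪f' y, x - y⟫) := by
  rcases hL.eq_or_lt with h0 | h0
  · have h2 := hs.dist_le_mul x y
    rw [dist_eq_norm, ← h0] at h2
    simp at h2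
    rw [← h0, h2]; simp
  · have h1 := aux_desc hg hL hs x (-(L⁻¹ • (f' x - f' y)))
    have h2 := aux_conv hg hc y (x + -(L⁻¹ • (f' x - f' y)))
    have h3 : x + -(L⁻¹ • (f' x - f' y)) - y = (x - y) - L⁻¹ • (f' x - f' y) := by abel
    rw [h3, inner_sub_right, inner_smul_right] at h2
    rw [inner_neg_right, inner_smul_right, norm_neg, norm_smul, mul_pow,
      Real.norm_of_nonneg (inv_nonneg.2 hL)] at h1
    have h4 : ⟪f' x, f' x - f' y⟫ - ⟪f' y, f' x - f' y⟫ = ‖f' x - f' y‖ ^ 2 := by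
      rw [← inner_sub_left, real_inner_self_eq_norm_sq]
    have h5 : L / 2 * (L⁻¹ ^ 2 * ‖f' x - f' y‖ ^ 2) = L⁻¹ * ‖f' x - f' y‖ ^ 2 / 2 := by
      field_simp
    rw [h5] at h1
    have h6 : L⁻¹ * ‖f' x - f' y‖ ^ 2 / 2 ≤ f x - f y - ⟪f' y, x - y⟫ := by
      have : L⁻¹ * ⟪f' x, f' x - f' y⟫ - L⁻¹ * ⟪f' y, f' x - f' y⟫ = L⁻¹ * ‖f' x - f' y‖ ^ 2 := by
        rw [← mul_sub, h4]
      linarith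
    calc ‖f' x - f' y‖ ^ 2 = 2 * L * (L⁻¹ * ‖f' x - f' y‖ ^ 2 / 2) := by field_simp
      _ ≤ _ := by gcongr

/-- Lemma `L2sp` of the paper: expected smoothness constant ℒ₂ for
sampling with replacement: τ indices are drawn i.i.d. from the distribution `pt`. -/
theorem L2_sampling_with_replacement
    {d n : ℕ} (hn : 0 < n) (τ : ℕ) (hτ : 1 ≤ τ)
    (f : Fin n → EuclideanSpace ℝ (Fin d) → ℝ)
    (f' : Fin n → EuclideanSpace ℝ (Fin d) → EuclideanSpace ℝ (Fin d))
    (hgrad : ∀ i x, HasGradientAt (f i) (f' i x) x)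
    (L : Fin n → ℝ) (hL0 : ∀ i, 0 ≤ L i)
    (hconv : ∀ i, ConvexOn ℝ Set.univ (f i))
    (hsmooth : ∀ i, LipschitzWith (Real.toNNReal (L i)) (f' i))
    (fbar : EuclideanSpace ℝ (Fin d) → ℝ)
    (hfbar : ∀ u, fbar u = (n : ℝ)⁻¹ * ∑ i, f i u)
    (fgrad : EuclideanSpace ℝ (Fin d) → EuclideanSpace ℝ (Fin d))
    (hfgrad : ∀ u, fgrad u = (n : ℝ)⁻¹ • ∑ i, f' i u)
    (pt : Fin n → ℝ) (hpt : ∀ i, 0 < pt i) (hptsum : ∑ i, pt i = 1)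
    (x y : EuclideanSpace ℝ (Fin d)) :
    ∑ idx : Fin τ → Fin n, (∏ k, pt (idx k)) *
        ‖((n : ℝ) * (τ : ℝ))⁻¹ • ∑ k, (pt (idx k))⁻¹ • (f' (idx k) x - f' (idx k) y)
            - (fgrad x - fgrad y)‖ ^ 2
      ≤ 2 / ((n : ℝ) * (τ : ℝ)) *
          (Finset.univ.sup' (Finset.univ_nonempty_iff.mpr (Fin.pos_iff_nonempty.mp hn))
            (fun i => L i / pt i))
        * (fbar x - fbar y - ⟪fgrad y, x - y⟫) := by
  have hn' : (0 : ℝ) < n := by exact_mod_cast hn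
  have ht' : (0 : ℝ) < τ := by exact_mod_cast hτ
  set M := Finset.univ.sup' (Finset.univ_nonempty_iff.mpr (Fin.pos_iff_nonempty.mp hn))
            (fun i => L i / pt i) with hM
  have hLM : ∀ i, L i / pt i ≤ M := fun i =>
    Finset.le_sup' (fun i => L i / pt i) (Finset.mem_univ i)
  set G := fgrad x - fgrad y with hG
  have hGe : G = (n : ℝ)⁻¹ • ∑ i, (f' i x - f' i y) := by
    rw [hG, hfgrad, hfgrad, Finset.sum_sub_distrib, smul_sub]
  let u : Fin n → EuclideanSpace ℝ (Fin d) := fun i => ((n : ℝ)⁻¹ * (pt i)⁻¹) • (f' i x - f' i y)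
  have hu : ∑ i, pt i • u i = G := by
    rw [hGe, Finset.smul_sum]
    refine Finset.sum_congr rfl fun i _ => ?_
    have := (hpt i).ne'
    simp only [u, smul_smul]
    congr 1
    field_simp
  have hw : ∑ i, pt i • (u i - G) = 0 := by
    simp only [smul_sub, Finset.sum_sub_distrib, hu, ← Finset.sum_smul, hptsum, one_smul, sub_self]
  have hV := aux_var pt hptsum (fun i => u i - G) hw τ 0
  have hterm : ∀ idx : Fin τ → Fin n,
      ((n : ℝ) * (τ : ℝ))⁻¹ • ∑ k, (pt (idx k))⁻¹ • (f' (idx k) x - f' (idx k) y) - G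
        = (τ : ℝ)⁻¹ • (0 + ∑ k, (u (idx k) - G)) := by
    intro idx
    rw [zero_add, Finset.sum_sub_distrib, smul_sub]
    congr 1
    · rw [Finset.smul_sum, Finset.smul_sum]
      refine Finset.sum_congr rfl fun k _ => ?_
      simp only [u, smul_smul]
      congr 1
      rw [mul_inv]; ring
    · simp only [Finset.sum_const, Finset.card_univ, Fintype.card_fin, ← Nat.cast_smul_eq_nsmul ℝ,
        smul_smul]
      rw [inv_mul_cancel₀ ht'.ne', one_smul]
  have hlhs : ∑ idx : Fin τ → Fin n, (∏ k, pt (idx k)) *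
        ‖((n : ℝ) * (τ : ℝ))⁻¹ • ∑ k, (pt (idx k))⁻¹ • (f' (idx k) x - f' (idx k) y) - G‖ ^ 2
      = (τ : ℝ)⁻¹ * ∑ i, pt i * ‖u i - G‖ ^ 2 := by
    have : (τ : ℝ)⁻¹ * ∑ i, pt i * ‖u i - G‖ ^ 2
        = (τ : ℝ)⁻¹ ^ 2 * (‖(0 : EuclideanSpace ℝ (Fin d))‖ ^ 2
          + τ * ∑ i, pt i * ‖u i - G‖ ^ 2) := by
      rw [norm_zero]; field_simp; ring
    rw [this, ← hV, Finset.mul_sum]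
    refine Finset.sum_congr rfl fun idx _ => ?_
    rw [hterm, norm_smul, mul_pow, Real.norm_of_nonneg (inv_nonneg.2 ht'.le)]
    ring
  have hvar : ∑ i, pt i * ‖u i - G‖ ^ 2 ≤ ∑ i, pt i * ‖u i‖ ^ 2 := by
    have : ∑ i, pt i * ‖u i - G‖ ^ 2 = ∑ i, pt i * ‖u i‖ ^ 2 - ‖G‖ ^ 2 := by
      have h1 : ∀ i, pt i * ‖u i - G‖ ^ 2
          = pt i * ‖u i‖ ^ 2 - 2 * ⟪pt i • u i, G⟫ + pt i * ‖G‖ ^ 2 := by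
        intro i
        rw [norm_sub_sq_real, real_inner_smul_left (u i) G (pt i)]; ring
      rw [Finset.sum_congr rfl fun i _ => h1 i, Finset.sum_add_distrib, Finset.sum_sub_distrib,
        ← Finset.mul_sum, ← sum_inner, hu, ← Finset.sum_mul, hptsum, real_inner_self_eq_norm_sq]
      ring
    rw [this]
    linarith [sq_nonneg ‖G‖]
  have hD : ∑ i, (f i x - f i y - ⟪f' i y, x - y⟫)
      = n * (fbar x - fbar y - ⟪fgrad y, x - y⟫) := by
    rw [hfbar, hfbar, hfgrad, real_inner_smul_left, sum_inner, Finset.sum_sub_distrib,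
      Finset.sum_sub_distrib]
    field_simp
  have hmain : ∑ i, pt i * ‖u i‖ ^ 2
      ≤ ∑ i, (n : ℝ)⁻¹ ^ 2 * (2 * M * (f i x - f i y - ⟪f' i y, x - y⟫)) := by
    refine Finset.sum_le_sum fun i _ => ?_
    have hp := hpt i
    have h1 := aux_coco (hgrad i) (hL0 i) (hsmooth i) (hconv i) x y
    have h2 : 0 ≤ f i x - f i y - ⟪f' i y, x - y⟫ := by
      linarith [aux_conv (hgrad i) (hconv i) y x]
    have h3 : pt i * ‖u i‖ ^ 2 = (n : ℝ)⁻¹ ^ 2 * ((pt i)⁻¹ * ‖f' i x - f' i y‖ ^ 2) := by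
      simp only [u]
      rw [norm_smul, mul_pow, Real.norm_of_nonneg (by positivity)]
      field_simp
    rw [h3]
    refine mul_le_mul_of_nonneg_left ?_ (by positivity)
    calc (pt i)⁻¹ * ‖f' i x - f' i y‖ ^ 2
        ≤ (pt i)⁻¹ * (2 * L i * (f i x - f i y - ⟪f' i y, x - y⟫)) := by gcongr
      _ = 2 * (L i / pt i) * (f i x - f i y - ⟪f' i y, x - y⟫) := by field_simp
      _ ≤ _ := by gcongr; exact hLM i
  rw [hlhs]
  rw [← Finset.mul_sum, ← Finset.mul_sum, hD] at hmain
  calc (τ : ℝ)⁻¹ * ∑ i, pt i * ‖u i - G‖ ^ 2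
      ≤ (τ : ℝ)⁻¹ * ((n : ℝ)⁻¹ ^ 2 * (2 * M * (n * (fbar x - fbar y - ⟪fgrad y, x - y⟫)))) := by
        gcongr; exact hvar.trans hmain
    _ = _ := by field_simp
end

section
/- Let f_i : ℝ^d → ℝ be differentiable and L_i-smooth (not necessarily convex), and set f = (1/n) Σ_{i=1}^n f_i. Let a sampling with weights p_C and weights θ^i_C be unbiased, and define β_i := Σ_{C : i∈C} p_C |C| (θ^i_C)², where |C| is the cardinality of C. Then for all x, y ∈ ℝ^d: E_S ‖(1/n) Σ_{i∈S} θ^i_S (∇f_i(x) − ∇f_i(y)) − (∇f(x) − ∇f(y))‖² ≤ (1/n²) Σ_{i=1}^n β_i L_i² ‖x − y‖². -/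
open scoped RealInnerProductSpace BigOperators

/-- Lemma `L3sampling(ii)` of the paper: bound on the variance constant ℒ₃
via the parameters `β_i = Σ_{C : i∈C} p_C |C| (θ^i_C)²`, for possibly nonconvex `f_i`. -/
theorem L3_beta_bound
    {d n : ℕ}
    (f : Fin n → EuclideanSpace ℝ (Fin d) → ℝ)
    (f' : Fin n → EuclideanSpace ℝ (Fin d) → EuclideanSpace ℝ (Fin d))
    (hgrad : ∀ i x, HasGradientAt (f i) (f' i x) x)
    (L : Fin n → ℝ) (hL0 : ∀ i, 0 ≤ L i)
    (hsmooth : ∀ i, LipschitzWith (Real.toNNReal (L i)) (f' i))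
    (fbar : EuclideanSpace ℝ (Fin d) → ℝ)
    (hfbar : ∀ u, fbar u = (n : ℝ)⁻¹ * ∑ i, f i u)
    (fgrad : EuclideanSpace ℝ (Fin d) → EuclideanSpace ℝ (Fin d))
    (hfgrad : ∀ u, fgrad u = (n : ℝ)⁻¹ • ∑ i, f' i u)
    (pC : Finset (Fin n) → ℝ) (hpC : ∀ C, 0 ≤ pC C) (hpCsum : ∑ C, pC C = 1)
    (θ : Finset (Fin n) → Fin n → ℝ)
    (hunbias : ∀ i, ∑ C ∈ Finset.univ.filter (fun C => i ∈ C), pC C * θ C i = 1)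
    (β : Fin n → ℝ)
    (hβ : ∀ i, β i = ∑ C ∈ Finset.univ.filter (fun C => i ∈ C),
        pC C * (C.card : ℝ) * (θ C i) ^ 2) :
    ∀ x y : EuclideanSpace ℝ (Fin d),
      ∑ C, pC C *
          ‖(n : ℝ)⁻¹ • ∑ i ∈ C, θ C i • (f' i x - f' i y) - (fgrad x - fgrad y)‖ ^ 2
        ≤ ((n : ℝ) ^ 2)⁻¹ * (∑ i, β i * L i ^ 2) * ‖x - y‖ ^ 2 := by
  intro x y
  have hg : ∀ i, ‖f' i x - f' i y‖ ^ 2 ≤ L i ^ 2 * ‖x - y‖ ^ 2 := by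
    intro i
    have h := (hsmooth i).norm_sub_le x y
    rw [Real.coe_toNNReal _ (hL0 i)] at h
    rw [← mul_pow]
    exact pow_le_pow_left₀ (norm_nonneg _) h 2
  have hm : fgrad x - fgrad y = (n : ℝ)⁻¹ • ∑ i, (f' i x - f' i y) := by
    rw [hfgrad, hfgrad, ← smul_sub, Finset.sum_sub_distrib]
  rw [hm]
  generalize hgd : (fun i => f' i x - f' i y) = g
  have hgi : ∀ i, f' i x - f' i y = g i := fun i => congrFun hgd i
  simp only [hgi] at hg ⊢
  have hmean : ∑ C, pC C • ((n : ℝ)⁻¹ • ∑ i ∈ C, θ C i • g i) = (n : ℝ)⁻¹ • ∑ i, g i := by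
    rw [Finset.sum_congr rfl fun C _ => smul_comm (pC C) ((n : ℝ)⁻¹) (∑ i ∈ C, θ C i • g i)]
    rw [← Finset.smul_sum]
    congr 1
    simp only [Finset.smul_sum, smul_smul]
    rw [Finset.sum_comm' (t' := Finset.univ)
      (s' := fun i => Finset.univ.filter (fun C => i ∈ C)) (by simp)]
    refine Finset.sum_congr rfl fun i _ => ?_
    rw [← Finset.sum_smul, hunbias, one_smul]
  have hvar : ∀ (X : Finset (Fin n) → EuclideanSpace ℝ (Fin d)) (m : EuclideanSpace ℝ (Fin d)),
      ∑ C, pC C • X C = m → ∑ C, pC C * ‖X C - m‖ ^ 2 ≤ ∑ C, pC C * ‖X C‖ ^ 2 := by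
    intro X m h
    have h1 : ∑ C, pC C * ⟪X C, m⟫ = ‖m‖ ^ 2 := by
      rw [← real_inner_self_eq_norm_sq]
      nth_rewrite 2 [← h]
      rw [sum_inner]
      simp only [real_inner_smul_left]
    have h2 : ∑ C, pC C * ‖X C - m‖ ^ 2
        = ∑ C, pC C * ‖X C‖ ^ 2 - 2 * ∑ C, pC C * ⟪X C, m⟫ + (∑ C, pC C) * ‖m‖ ^ 2 := by
      rw [Finset.mul_sum, Finset.sum_mul, ← Finset.sum_sub_distrib, ← Finset.sum_add_distrib]
      refine Finset.sum_congr rfl fun C _ => ?_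
      rw [norm_sub_sq_real]
      ring
    rw [h2, h1, hpCsum]
    nlinarith [sq_nonneg ‖m‖]
  refine (hvar _ _ hmean).trans ?_
  have hX : ∀ C : Finset (Fin n), ‖(n : ℝ)⁻¹ • ∑ i ∈ C, θ C i • g i‖ ^ 2
      ≤ ((n : ℝ) ^ 2)⁻¹ * ∑ i ∈ C, (C.card : ℝ) * θ C i ^ 2 * (L i ^ 2 * ‖x - y‖ ^ 2) := by
    intro C
    rw [norm_smul, mul_pow, norm_inv, inv_pow, Real.norm_natCast]
    gcongr
    calc ‖∑ i ∈ C, θ C i • g i‖ ^ 2 ≤ (∑ i ∈ C, ‖θ C i • g i‖) ^ 2 := by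
          gcongr; exact norm_sum_le _ _
      _ ≤ C.card * ∑ i ∈ C, ‖θ C i • g i‖ ^ 2 := sq_sum_le_card_mul_sum_sq
      _ ≤ _ := by
          rw [Finset.mul_sum]
          refine Finset.sum_le_sum fun i _ => ?_
          rw [norm_smul, mul_pow, Real.norm_eq_abs, sq_abs, mul_assoc]
          exact mul_le_mul_of_nonneg_left
            (mul_le_mul_of_nonneg_left (hg i) (sq_nonneg _)) (Nat.cast_nonneg _)
  refine (Finset.sum_le_sum fun C _ => mul_le_mul_of_nonneg_left (hX C) (hpC C)).trans
    (le_of_eq ?_)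
  simp only [hβ, Finset.sum_mul, Finset.mul_sum]
  rw [Finset.sum_comm' (t' := Finset.univ)
      (s' := fun i => Finset.univ.filter (fun C => i ∈ C)) (by simp)]
  refine Finset.sum_congr rfl fun i _ => Finset.sum_congr rfl fun C _ => ?_
  ring
end

section
/- Let n ≥ 2, 1 ≤ τ ≤ n, let f_i : ℝ^d → ℝ be differentiable and L_i-smooth (not necessarily convex), and set f = (1/n) Σ_{i=1}^n f_i. Let S be the τ-nice sampling (uniform over all subsets of [n] of cardinality τ). Then for all x, y ∈ ℝ^d: E_S ‖(1/n) Σ_{i∈S} (n/τ)(∇f_i(x) − ∇f_i(y)) − (∇f(x) − ∇f(y))‖² ≤ ((n−τ)/(τ(n−1))) · (1/n) Σ_{i=1}^n L_i² · ‖x − y‖². -/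
open scoped RealInnerProductSpace BigOperators

theorem aux_count {n : ℕ} (τ : ℕ) (hτ1 : 1 ≤ τ) (i j : Fin n) (hij : i ≠ j) :
    (Finset.univ.filter (fun C : Finset (Fin n) => C.card = τ ∧ i ∈ C ∧ j ∉ C)).card
      = (n - 2).choose (τ - 1) := by
  classical
  have h2 : ((Finset.univ.erase i).erase j).card = n - 2 := by
    rw [Finset.card_erase_of_mem (by simp [hij.symm]), Finset.card_erase_of_mem (by simp)]
    simp
    omega
  rw [← h2, ← Finset.card_powersetCard]
  refine Finset.card_bij' (fun C _ => C.erase i) (fun C _ => insert i C) ?_ ?_ ?_ ?_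
  · intro C hC
    simp only [Finset.mem_filter, Finset.mem_univ, true_and] at hC
    rw [Finset.mem_powersetCard]
    refine ⟨?_, by rw [Finset.card_erase_of_mem hC.2.1, hC.1]⟩
    intro k hk
    have hk' := Finset.mem_erase.1 hk
    simp only [Finset.mem_erase, Finset.mem_univ, and_true]
    exact ⟨fun h => hC.2.2 (h ▸ hk'.2), hk'.1⟩
  · intro C hC
    rw [Finset.mem_powersetCard] at hC
    have hi : i ∉ C := fun h => by simpa using hC.1 h
    have hj : j ∉ C := fun h => by simpa using hC.1 h
    simp [Finset.card_insert_of_notMem hi, hC.2, hj, hij.symm]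
    omega
  · intro C hC
    simp only [Finset.mem_filter, Finset.mem_univ, true_and] at hC
    exact Finset.insert_erase hC.2.1
  · intro C hC
    rw [Finset.mem_powersetCard] at hC
    have hi : i ∉ C := fun h => by simpa using hC.1 h
    exact Finset.erase_insert hi

theorem aux_choose {n : ℕ} (hn : 2 ≤ n) (τ : ℕ) (hτ1 : 1 ≤ τ) (hτn : τ ≤ n) :
    ((n - 2).choose (τ - 1) : ℝ) * (n * (n - 1)) = n.choose τ * (τ * (n - τ)) := by
  obtain ⟨m, rfl⟩ := Nat.exists_eq_add_of_le hn
  obtain ⟨t, rfl⟩ := Nat.exists_eq_add_of_le hτ1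
  have e1 : 2 + m - 2 = m := by omega
  have e2 : 1 + t - 1 = t := by omega
  rw [e1, e2]
  have h1 := Nat.add_one_mul_choose_eq (m + 1) t
  have h2 := Nat.choose_mul_succ_eq m t
  have h3 : t ≤ m + 1 := by omega
  rw [show 2 + m = m + 1 + 1 by ring, show 1 + t = t + 1 by ring]
  have h1' : ((m : ℝ) + 1 + 1) * ((m + 1).choose t : ℝ)
      = ((m + 1 + 1).choose (t + 1) : ℝ) * ((t : ℝ) + 1) := by exact_mod_cast h1
  have h2' : (m.choose t : ℝ) * ((m : ℝ) + 1) = ((m + 1).choose t : ℝ) * ((m : ℝ) + 1 - t) := by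
    have := congrArg (Nat.cast : ℕ → ℝ) h2
    rw [Nat.cast_mul, Nat.cast_mul, Nat.cast_sub h3] at this
    exact_mod_cast this
  push_cast
  linear_combination ((m : ℝ) + 2) * h2' + ((m : ℝ) + 1 - t) * h1'

theorem aux_sum {E : Type*} [NormedAddCommGroup E] [InnerProductSpace ℝ E] {n : ℕ}
    (τ : ℕ) (hτ1 : 1 ≤ τ) (b : Fin n → E) (hb : ∑ i, b i = 0) :
    ∑ C ∈ Finset.univ.filter (fun C : Finset (Fin n) => C.card = τ), ‖∑ i ∈ C, b i‖ ^ 2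
      = ((n - 2).choose (τ - 1) : ℝ) * ∑ i, ‖b i‖ ^ 2 := by
  classical
  have h1 : ∀ C : Finset (Fin n), ‖∑ i ∈ C, b i‖ ^ 2
      = ∑ i, ∑ j, if i ∈ C ∧ j ∉ C then -(inner ℝ (b i) (b j)) else 0 := by
    intro C
    have hc : ∑ i ∈ C, b i = -∑ j ∈ Cᶜ, b j := by
      rw [eq_neg_iff_add_eq_zero, Finset.sum_add_sum_compl, hb]
    rw [← real_inner_self_eq_norm_sq]
    nth_rewrite 2 [hc]
    rw [inner_neg_right, sum_inner]
    simp_rw [inner_sum]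
    rw [← Finset.sum_neg_distrib, ← Finset.sum_filter_add_sum_filter_not Finset.univ (· ∈ C)]
    have hz : ∑ i ∈ Finset.univ.filter (fun i => ¬ i ∈ C), ∑ j,
        (if i ∈ C ∧ j ∉ C then -(inner ℝ (b i) (b j)) else 0) = 0 := by
      refine Finset.sum_eq_zero fun i hi => Finset.sum_eq_zero fun j _ => ?_
      rw [if_neg]
      exact fun h => (Finset.mem_filter.1 hi).2 h.1
    rw [hz, add_zero, Finset.filter_univ_mem]
    refine Finset.sum_congr rfl fun i hi => ?_
    simp only [hi, true_and]
    rw [← Finset.sum_filter, ← Finset.sum_neg_distrib]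
    refine Finset.sum_congr ?_ fun _ _ => rfl
    ext j
    simp
  simp_rw [h1]
  rw [Finset.sum_comm, Finset.mul_sum]
  refine Finset.sum_congr rfl fun i _ => ?_
  rw [Finset.sum_comm]
  have h2 : ∀ j, ∑ C ∈ Finset.univ.filter (fun C : Finset (Fin n) => C.card = τ),
      (if i ∈ C ∧ j ∉ C then -(inner ℝ (b i) (b j)) else 0)
      = ((n - 2).choose (τ - 1) : ℝ) * (-(inner ℝ (b i) (b j))
        + if i = j then ‖b i‖ ^ 2 else 0) := by
    intro j
    by_cases hij : i = j
    · subst hij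
      rw [if_pos rfl, real_inner_self_eq_norm_sq]
      simp
    · rw [if_neg hij, ← Finset.sum_filter, Finset.filter_filter, Finset.sum_const,
        aux_count τ hτ1 i j hij, nsmul_eq_mul, add_zero]
  simp_rw [h2]
  rw [← Finset.mul_sum, Finset.sum_add_distrib, Finset.sum_neg_distrib, ← inner_sum, hb]
  simp

/-- Lemma `L3nsgs(i)` of the paper: bound on the constant ℒ₃ for τ-nice
sampling (uniform over subsets of cardinality τ) with `θ^i_S = n/τ`, `f_i` possibly
nonconvex. -/
theorem L3_nice_sampling
    {d n : ℕ} (hn : 2 ≤ n) (τ : ℕ) (hτ1 : 1 ≤ τ) (hτn : τ ≤ n)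
    (f : Fin n → EuclideanSpace ℝ (Fin d) → ℝ)
    (f' : Fin n → EuclideanSpace ℝ (Fin d) → EuclideanSpace ℝ (Fin d))
    (hgrad : ∀ i x, HasGradientAt (f i) (f' i x) x)
    (L : Fin n → ℝ) (hL0 : ∀ i, 0 ≤ L i)
    (hsmooth : ∀ i, LipschitzWith (Real.toNNReal (L i)) (f' i))
    (fbar : EuclideanSpace ℝ (Fin d) → ℝ)
    (hfbar : ∀ u, fbar u = (n : ℝ)⁻¹ * ∑ i, f i u)
    (fgrad : EuclideanSpace ℝ (Fin d) → EuclideanSpace ℝ (Fin d))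
    (hfgrad : ∀ u, fgrad u = (n : ℝ)⁻¹ • ∑ i, f' i u)
    (x y : EuclideanSpace ℝ (Fin d)) :
    ∑ C ∈ Finset.univ.filter (fun C : Finset (Fin n) => C.card = τ),
        ((n.choose τ : ℝ))⁻¹ *
          ‖(n : ℝ)⁻¹ • ∑ i ∈ C, ((n : ℝ) / (τ : ℝ)) • (f' i x - f' i y)
              - (fgrad x - fgrad y)‖ ^ 2
      ≤ (((n : ℝ) - (τ : ℝ)) / ((τ : ℝ) * ((n : ℝ) - 1)))
          * ((n : ℝ)⁻¹ * ∑ i, L i ^ 2) * ‖x - y‖ ^ 2 := by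
  have hn0 : (0:ℝ) < n := by exact_mod_cast (by omega : 0 < n)
  have hn1 : (0:ℝ) < (n:ℝ) - 1 := by
    have : (2:ℝ) ≤ n := by exact_mod_cast hn
    linarith
  have ht0 : (0:ℝ) < τ := by exact_mod_cast hτ1
  have htn : (0:ℝ) ≤ (n:ℝ) - τ := by
    have : (τ:ℝ) ≤ n := by exact_mod_cast hτn
    linarith
  have hch : (0:ℝ) < n.choose τ := by exact_mod_cast Nat.choose_pos hτn
  set a : Fin n → EuclideanSpace ℝ (Fin d) := fun i => f' i x - f' i y with ha
  set m : EuclideanSpace ℝ (Fin d) := (n : ℝ)⁻¹ • ∑ i, a i with hm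
  have hfg : fgrad x - fgrad y = m := by
    rw [hfgrad, hfgrad, ← smul_sub, ← Finset.sum_sub_distrib]
  have hnm : (n : ℝ) • m = ∑ i, a i := by
    rw [hm, smul_smul, mul_inv_cancel₀ hn0.ne', one_smul]
  have hb : ∑ i, (a i - m) = 0 := by
    rw [Finset.sum_sub_distrib, ← hnm]
    simp [← Nat.cast_smul_eq_nsmul ℝ]
  have hterm : ∀ C ∈ Finset.univ.filter (fun C : Finset (Fin n) => C.card = τ),
      ((n.choose τ : ℝ))⁻¹ *
          ‖(n : ℝ)⁻¹ • ∑ i ∈ C, ((n : ℝ) / (τ : ℝ)) • (f' i x - f' i y)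
              - (fgrad x - fgrad y)‖ ^ 2
        = (((n.choose τ : ℝ))⁻¹ * ((τ:ℝ)⁻¹) ^ 2) * ‖∑ i ∈ C, (a i - m)‖ ^ 2 := by
    intro C hC
    have hC' : C.card = τ := (Finset.mem_filter.1 hC).2
    have : (n : ℝ)⁻¹ • ∑ i ∈ C, ((n : ℝ) / (τ : ℝ)) • (f' i x - f' i y)
              - (fgrad x - fgrad y) = (τ:ℝ)⁻¹ • ∑ i ∈ C, (a i - m) := by
      rw [hfg, ← Finset.smul_sum, smul_smul, Finset.sum_sub_distrib a (fun _ => m), Finset.sum_const, hC',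
        ← Nat.cast_smul_eq_nsmul ℝ, smul_sub, smul_smul, inv_mul_cancel₀ ht0.ne', one_smul]
      congr 2
      field_simp
    rw [this, norm_smul, mul_pow, Real.norm_of_nonneg (by positivity)]
    ring
  rw [Finset.sum_congr rfl hterm, ← Finset.mul_sum, aux_sum τ hτ1 _ hb]
  have hvar : ∑ i, ‖a i - m‖ ^ 2 ≤ ∑ i, ‖a i‖ ^ 2 := by
    have : ∑ i, ‖a i - m‖ ^ 2 = ∑ i, ‖a i‖ ^ 2 - n * ‖m‖ ^ 2 := by
      simp_rw [norm_sub_sq_real]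
      rw [Finset.sum_add_distrib, Finset.sum_sub_distrib, ← Finset.mul_sum, ← sum_inner, ← hnm,
        real_inner_smul_left, real_inner_self_eq_norm_sq]
      simp
      ring
    rw [this]
    have : 0 ≤ n * ‖m‖ ^ 2 := by positivity
    linarith
  have hlip : ∑ i, ‖a i‖ ^ 2 ≤ (∑ i, L i ^ 2) * ‖x - y‖ ^ 2 := by
    rw [Finset.sum_mul]
    refine Finset.sum_le_sum fun i _ => ?_
    have h := (hsmooth i).dist_le_mul x y
    rw [dist_eq_norm, dist_eq_norm, Real.coe_toNNReal _ (hL0 i)] at h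
    rw [← mul_pow]
    exact pow_le_pow_left₀ (norm_nonneg _) h 2
  have hcoef : (((n.choose τ : ℝ))⁻¹ * ((τ:ℝ)⁻¹) ^ 2) * ((n - 2).choose (τ - 1) : ℝ)
      = (((n : ℝ) - (τ : ℝ)) / ((τ : ℝ) * ((n : ℝ) - 1))) * (n : ℝ)⁻¹ := by
    have h := aux_choose hn τ hτ1 hτn
    field_simp
    linear_combination h
  rw [← mul_assoc, hcoef]
  calc _ ≤ (((n : ℝ) - (τ : ℝ)) / ((τ : ℝ) * ((n : ℝ) - 1))) * (n : ℝ)⁻¹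
        * ((∑ i, L i ^ 2) * ‖x - y‖ ^ 2) :=
        mul_le_mul_of_nonneg_left (hvar.trans hlip) (by positivity)
    _ = _ := by ring
end

section
/- Let f_i : ℝ^d → ℝ be differentiable and L_i-smooth with L_i > 0, set f = (1/n) Σ_{i=1}^n f_i, L̄ := (1/n) Σ_{i=1}^n L_i, and let τ > 0. Set q_i := τ L_i / Σ_{j=1}^n L_j, and let S be a group sampling with marginals p_i satisfying min{q_i, 1} ≤ p_i ≤ 1 for all i. Then for all x, y ∈ ℝ^d: E_S ‖(1/n) Σ_{i∈S} (1/p_i)(∇f_i(x) − ∇f_i(y)) − (∇f(x) − ∇f(y))‖² ≤ (L̄²/τ) ‖x − y‖². -/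
open scoped RealInnerProductSpace BigOperators

lemma aux_expand {E : Type*} [NormedAddCommGroup E] [InnerProductSpace ℝ E] {n : ℕ}
    (pC : Finset (Fin n) → ℝ) (hpCsum : ∑ C, pC C = 1) (p : Fin n → ℝ)
    (hmarg : ∀ i, ∑ C ∈ Finset.univ.filter (fun C => i ∈ C), pC C = p i)
    (b : Fin n → E) :
    ∑ C, pC C * ‖∑ i ∈ C, b i - ∑ i, p i • b i‖ ^ 2 =
      ∑ i, ∑ j, (∑ C ∈ Finset.univ.filter (fun C => i ∈ C ∧ j ∈ C), pC C) * ⟪b i, b j⟫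
        - ‖∑ i, p i • b i‖ ^ 2 := by
  have h1 : ∑ C, pC C * ‖∑ i ∈ C, b i‖ ^ 2 =
      ∑ i, ∑ j, (∑ C ∈ Finset.univ.filter (fun C => i ∈ C ∧ j ∈ C), pC C) * ⟪b i, b j⟫ := by
    have : ∀ C : Finset (Fin n), pC C * ‖∑ i ∈ C, b i‖ ^ 2 =
        ∑ i, ∑ j, (if i ∈ C ∧ j ∈ C then pC C else 0) * ⟪b i, b j⟫ := by
      intro C
      have hs : ∑ i ∈ C, b i = ∑ i, if i ∈ C then b i else 0 := by simp
      rw [← real_inner_self_eq_norm_sq, hs, sum_inner, Finset.mul_sum]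
      refine Finset.sum_congr rfl fun i _ => ?_
      rw [inner_sum, Finset.mul_sum]
      refine Finset.sum_congr rfl fun j _ => ?_
      by_cases hi : i ∈ C <;> by_cases hj : j ∈ C <;> simp [hi, hj]
    simp_rw [this]
    rw [Finset.sum_comm]
    refine Finset.sum_congr rfl fun i _ => ?_
    rw [Finset.sum_comm]
    refine Finset.sum_congr rfl fun j _ => ?_
    rw [← Finset.sum_mul, Finset.sum_filter]
  have h2 : ∑ C, pC C • ∑ i ∈ C, b i = ∑ i, p i • b i := by
    have : ∀ C : Finset (Fin n), pC C • ∑ i ∈ C, b i =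
        ∑ i, (if i ∈ C then pC C else 0) • b i := by
      intro C
      rw [Finset.smul_sum]
      simp [ite_smul]
    simp_rw [this]
    rw [Finset.sum_comm]
    refine Finset.sum_congr rfl fun i _ => ?_
    rw [← Finset.sum_smul, ← hmarg i, Finset.sum_filter]
  set A := ∑ i, p i • b i
  have h3 : ∑ C, pC C * ⟪∑ i ∈ C, b i, A⟫ = ‖A‖ ^ 2 := by
    rw [← real_inner_self_eq_norm_sq]
    rw [show ⟪A, A⟫ = ⟪∑ C, pC C • ∑ i ∈ C, b i, A⟫ by rw [h2]]
    rw [sum_inner]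
    exact Finset.sum_congr rfl fun C _ => (real_inner_smul_left _ _ _).symm
  have h4 : ∀ C : Finset (Fin n), pC C * ‖∑ i ∈ C, b i - A‖ ^ 2 =
      pC C * ‖∑ i ∈ C, b i‖ ^ 2 - 2 * (pC C * ⟪∑ i ∈ C, b i, A⟫) + pC C * ‖A‖ ^ 2 := by
    intro C
    rw [norm_sub_sq_real]; ring
  simp_rw [h4]
  rw [Finset.sum_add_distrib, Finset.sum_sub_distrib, ← Finset.mul_sum, ← Finset.sum_mul,
    h1, h3, hpCsum]
  ring

lemma aux_group {E : Type*} [NormedAddCommGroup E] [InnerProductSpace ℝ E] {n t : ℕ}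
    (p : Fin n → ℝ) (hp0 : ∀ i, 0 < p i) (g : Fin n → Fin t)
    (P : Fin n → Fin n → ℝ) (hii : ∀ i, P i i = p i)
    (hs : ∀ i j, i ≠ j → g i = g j → P i j = 0)
    (hd : ∀ i j, g i ≠ g j → P i j = p i * p j)
    (a : Fin n → E) :
    ∑ i, ∑ j, P i j * ⟪(p i)⁻¹ • a i, (p j)⁻¹ • a j⟫ - ‖∑ i, a i‖ ^ 2 =
      ∑ k, (∑ i with g i = k, ‖a i‖ ^ 2 / p i - ‖∑ i with g i = k, a i‖ ^ 2) := by
  rw [Finset.sum_sub_distrib, Finset.sum_fiberwise]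
  have e1 : ‖∑ i, a i‖ ^ 2 = ∑ i, ∑ j, ⟪a i, a j⟫ := by
    rw [← real_inner_self_eq_norm_sq, sum_inner]
    simp_rw [inner_sum]
  have e2 : ∑ k, ‖∑ i with g i = k, a i‖ ^ 2 =
      ∑ i, ∑ j, if g i = g j then ⟪a i, a j⟫ else 0 := by
    rw [← Finset.sum_fiberwise (s := Finset.univ) (g := g)]
    refine Finset.sum_congr rfl fun k _ => ?_
    rw [← real_inner_self_eq_norm_sq, sum_inner]
    refine Finset.sum_congr rfl fun i hi => ?_
    have hi' : g i = k := by simpa using hi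
    rw [inner_sum, Finset.sum_filter]
    refine Finset.sum_congr rfl fun j _ => ?_
    simp [hi', eq_comm]
  have e3 : ∑ i, ‖a i‖ ^ 2 / p i = ∑ i, ∑ j, if i = j then ‖a i‖ ^ 2 / p i else 0 := by
    simp
  rw [e1, e2, e3]
  simp_rw [← Finset.sum_sub_distrib]
  refine Finset.sum_congr rfl fun i _ => Finset.sum_congr rfl fun j _ => ?_
  have hi := (hp0 i).ne'
  have hj := (hp0 j).ne'
  rw [real_inner_smul_left, real_inner_smul_right]
  by_cases hij : i = j
  · subst hij
    simp only [hii, if_true, real_inner_self_eq_norm_sq]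
    field_simp
  · by_cases hg : g i = g j
    · simp [hs i j hij hg, hij, hg]
    · rw [hd i j hg]
      simp only [hij, hg, if_false]
      field_simp
      ring

/-- Proposition `L3gs` of the paper: the importance group sampling with
marginals `p_i ≥ min{q_i, 1}`, `q_i = τ L_i / Σ_j L_j`, achieves `ℒ₃ ≤ L̄²/τ`. -/
theorem L3_importance_group_sampling
    {d n t : ℕ}
    (f : Fin n → EuclideanSpace ℝ (Fin d) → ℝ)
    (f' : Fin n → EuclideanSpace ℝ (Fin d) → EuclideanSpace ℝ (Fin d))
    (hgrad : ∀ i x, HasGradientAt (f i) (f' i x) x)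
    (L : Fin n → ℝ) (hL0 : ∀ i, 0 < L i)
    (hsmooth : ∀ i, LipschitzWith (Real.toNNReal (L i)) (f' i))
    (fbar : EuclideanSpace ℝ (Fin d) → ℝ)
    (hfbar : ∀ u, fbar u = (n : ℝ)⁻¹ * ∑ i, f i u)
    (fgrad : EuclideanSpace ℝ (Fin d) → EuclideanSpace ℝ (Fin d))
    (hfgrad : ∀ u, fgrad u = (n : ℝ)⁻¹ • ∑ i, f' i u)
    (τ : ℝ) (hτ : 0 < τ)
    -- marginals: min{q_i, 1} ≤ p_i ≤ 1 with q_i = τ L_i / Σ_j L_j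
    (p : Fin n → ℝ) (hp0 : ∀ i, 0 < p i) (hp1 : ∀ i, p i ≤ 1)
    (hpq : ∀ i, min (τ * L i / ∑ j, L j) 1 ≤ p i)
    -- groups
    (G : Fin t → Finset (Fin n))
    (hGdisj : ∀ j k, j ≠ k → Disjoint (G j) (G k))
    (hGcover : ∀ i : Fin n, ∃ j, i ∈ G j)
    (hGsum : ∀ j, ∑ i ∈ G j, p i ≤ 1)
    -- the group sampling distribution
    (pC : Finset (Fin n) → ℝ) (hpC : ∀ C, 0 ≤ pC C) (hpCsum : ∑ C, pC C = 1)
    (hmarg : ∀ i, ∑ C ∈ Finset.univ.filter (fun C => i ∈ C), pC C = p i)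
    (hsame : ∀ i j : Fin n, i ≠ j → (∃ k, i ∈ G k ∧ j ∈ G k) →
      ∑ C ∈ Finset.univ.filter (fun C => i ∈ C ∧ j ∈ C), pC C = 0)
    (hdiff : ∀ i j : Fin n, ¬ (∃ k, i ∈ G k ∧ j ∈ G k) →
      ∑ C ∈ Finset.univ.filter (fun C => i ∈ C ∧ j ∈ C), pC C = p i * p j)
    (x y : EuclideanSpace ℝ (Fin d)) :
    ∑ C, pC C *
        ‖(n : ℝ)⁻¹ • ∑ i ∈ C, (p i)⁻¹ • (f' i x - f' i y) - (fgrad x - fgrad y)‖ ^ 2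
      ≤ ((n : ℝ)⁻¹ * ∑ i, L i) ^ 2 / τ * ‖x - y‖ ^ 2 := by
  classical
  choose g hg using hGcover
  have hmem : ∀ i k, i ∈ G k → g i = k := by
    intro i k h
    by_contra hne
    exact Finset.disjoint_left.1 (hGdisj _ _ hne) (hg i) h
  have hiff : ∀ i j, (∃ k, i ∈ G k ∧ j ∈ G k) ↔ g i = g j := by
    intro i j
    constructor
    · rintro ⟨k, h1, h2⟩
      rw [hmem i k h1, hmem j k h2]
    · intro h
      exact ⟨g i, hg i, h ▸ hg j⟩
  have hGk : ∀ k, G k = Finset.univ.filter (fun i => g i = k) := by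
    intro k
    ext i
    simp only [Finset.mem_filter, Finset.mem_univ, true_and]
    exact ⟨hmem i k, fun h => h ▸ hg i⟩
  set a : Fin n → EuclideanSpace ℝ (Fin d) := fun i => f' i x - f' i y with ha
  set R := ‖x - y‖ with hR
  set S := ∑ j, L j with hS
  have haL : ∀ i, ‖a i‖ ≤ L i * R := by
    intro i
    have h := (hsmooth i).dist_le_mul x y
    rwa [dist_eq_norm, dist_eq_norm, Real.coe_toNNReal _ (hL0 i).le] at h
  have hfg : fgrad x - fgrad y = (n : ℝ)⁻¹ • ∑ i, a i := by
    rw [hfgrad, hfgrad, ← smul_sub, ← Finset.sum_sub_distrib]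
  have hpa : ∑ i, p i • (p i)⁻¹ • a i = ∑ i, a i := by
    refine Finset.sum_congr rfl fun i _ => ?_
    rw [smul_smul, mul_inv_cancel₀ (hp0 i).ne', one_smul]
  have hex := aux_expand pC hpCsum p hmarg (fun i => (p i)⁻¹ • a i)
  rw [hpa] at hex
  have hgr := aux_group p hp0 g
    (fun i j => ∑ C ∈ Finset.univ.filter (fun C => i ∈ C ∧ j ∈ C), pC C)
    (fun i => by simpa using hmarg i)
    (fun i j hij h => hsame i j hij ((hiff i j).2 h))
    (fun i j h => hdiff i j (fun h' => h ((hiff i j).1 h'))) a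
  rw [hgr] at hex
  have hbound : ∀ k : Fin t, (∑ i with g i = k, ‖a i‖ ^ 2 / p i - ‖∑ i with g i = k, a i‖ ^ 2)
      ≤ ∑ i with g i = k, L i * (S / τ * R ^ 2) := by
    intro k
    have hSn : 0 ≤ S := Finset.sum_nonneg fun i _ => (hL0 i).le
    have hrn : 0 ≤ ∑ i with g i = k, L i * (S / τ * R ^ 2) :=
      Finset.sum_nonneg fun i _ => mul_nonneg (hL0 i).le (by positivity)
    by_cases hone : ∃ i, g i = k ∧ p i = 1
    · obtain ⟨i, hik, hpi⟩ := hone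
      have hsing : Finset.univ.filter (fun i => g i = k) = {i} := by
        refine Finset.eq_singleton_iff_unique_mem.2 ⟨by simp [hik], ?_⟩
        intro j hj
        by_contra hne
        have h1 := hGsum k
        rw [hGk k] at h1
        have h2 : ∑ l ∈ ({i, j} : Finset (Fin n)), p l ≤ ∑ l with g l = k, p l := by
          refine Finset.sum_le_sum_of_subset_of_nonneg ?_ fun l _ _ => (hp0 l).le
          intro l hl
          rcases Finset.mem_insert.1 hl with rfl | hl
          · simp [hik]
          · rw [Finset.mem_singleton.1 hl]; exact hj
        rw [Finset.sum_pair (Ne.symm hne)] at h2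
        linarith [hp0 j]
      refine le_trans (le_of_eq ?_) hrn
      rw [hsing]
      simp [hpi]
    · push Not at hone
      refine le_trans (sub_le_self _ (sq_nonneg _)) (Finset.sum_le_sum fun i hi => ?_)
      have hik : g i = k := by simpa using hi
      have hlt : p i < 1 := lt_of_le_of_ne (hp1 i) (hone i hik)
      have hq : τ * L i / S ≤ p i := by
        rcases min_le_iff.1 (hpq i) with h | h
        · exact h
        · linarith
      have hSp : 0 < S := Finset.sum_pos (fun i _ => hL0 i) ⟨i, Finset.mem_univ i⟩
      rw [div_le_iff₀ hSp] at hq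
      have hsq : ‖a i‖ ^ 2 ≤ (L i * R) ^ 2 := pow_le_pow_left₀ (norm_nonneg _) (haL i) 2
      rw [div_le_iff₀ (hp0 i)]
      refine hsq.trans ?_
      have : L i * (S / τ * R ^ 2) * p i = (L i * R ^ 2 / τ) * (p i * S) := by ring
      rw [this]
      have h5 : (L i * R) ^ 2 = (L i * R ^ 2 / τ) * (τ * L i) := by field_simp
      rw [h5]
      exact mul_le_mul_of_nonneg_left hq
        (div_nonneg (mul_nonneg (hL0 i).le (sq_nonneg _)) hτ.le)
  have htot := Finset.sum_le_sum fun k (_ : k ∈ Finset.univ) => hbound k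
  rw [← hex, Finset.sum_fiberwise, ← Finset.sum_mul] at htot
  have hl : ∀ C : Finset (Fin n),
      pC C * ‖(n : ℝ)⁻¹ • ∑ i ∈ C, (p i)⁻¹ • a i - (fgrad x - fgrad y)‖ ^ 2 =
      ((n : ℝ)⁻¹) ^ 2 * (pC C * ‖∑ i ∈ C, (p i)⁻¹ • a i - ∑ i, a i‖ ^ 2) := by
    intro C
    rw [hfg, ← smul_sub, norm_smul, mul_pow, Real.norm_eq_abs, sq_abs]
    ring
  calc _ = ((n : ℝ)⁻¹) ^ 2 * ∑ C, (pC C * ‖∑ i ∈ C, (p i)⁻¹ • a i - ∑ i, a i‖ ^ 2) := by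
        rw [Finset.mul_sum]
        exact Finset.sum_congr rfl fun C _ => hl C
    _ ≤ ((n : ℝ)⁻¹) ^ 2 * (S * (S / τ * R ^ 2)) := mul_le_mul_of_nonneg_left htot (sq_nonneg _)
    _ = _ := by ring
end
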